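/- Let X be any real Banach space and let F : [0,1] → (nonempty bounded subsets of X) be a multifunction all of whose values F(t) are precompact (totally bounded), and suppose that conv F : t ↦ conv(F(t)) is Riemann integrable. Then F is Riemann integrable. -/

import Mathlib

open Pointwise

/-- A tagged partition of the interval `[0,1]`: subdivision points
`x 0 = 0 ≤ x 1 ≤ … ≤ x n = 1` together with tags `t i ∈ [x i, x (i+1)]`. -/
structure TaggedPartition where
  n : ℕ
  npos : 0 < n
  x : Fin (n + 1) → ℝ
  t : Fin n → ℝ
  mono : Monotone x
  x_zero : x 0 = 0
  x_last : x (Fin.last n) = 1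
  tag_mem : ∀ i : Fin n, t i ∈ Set.Icc (x i.castSucc) (x i.succ)

/-- The mesh `d(T)` of a tagged partition: the largest length of a subinterval. -/
noncomputable def TaggedPartition.mesh (T : TaggedPartition) : ℝ :=
  ⨆ i : Fin T.n, (T.x i.succ - T.x i.castSucc)

/-- The Riemann sum `S(F,T) = ∑ |Δ i| • F (t i)` of a multifunction `F`,
where the sum of sets is the Minkowski sum. -/
noncomputable def setRiemannSum {X : Type*} [NormedAddCommGroup X] [NormedSpace ℝ X]
    (F : ℝ → Set X) (T : TaggedPartition) : Set X :=
  ∑ i : Fin T.n, (T.x i.succ - T.x i.castSucc) • F (T.t i)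

/-- A closed bounded nonempty set `A` is the Riemann integral of the multifunction `F` if
the Riemann sums of `F` converge to `A` in the Hausdorff distance as the mesh tends to `0`. -/
def IsSetRiemannIntegral {X : Type*} [NormedAddCommGroup X] [NormedSpace ℝ X]
    (F : ℝ → Set X) (A : Set X) : Prop :=
  A.Nonempty ∧ IsClosed A ∧ Bornology.IsBounded A ∧
    ∀ ε > 0, ∃ δ > 0, ∀ T : TaggedPartition, T.mesh < δ →
      Metric.hausdorffDist (setRiemannSum F T) A < ε

/-- A multifunction is Riemann integrable if it has a Riemann integral. -/
def SetRiemannIntegrable {X : Type*} [NormedAddCommGroup X] [NormedSpace ℝ X]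
    (F : ℝ → Set X) : Prop :=
  ∃ A : Set X, IsSetRiemannIntegral F A

/-- `F` is a multifunction on `[0,1]` with nonempty bounded values. -/
def IsMultifunction {X : Type*} [NormedAddCommGroup X] (F : ℝ → Set X) : Prop :=
  ∀ t ∈ Set.Icc (0 : ℝ) 1, (F t).Nonempty ∧ Bornology.IsBounded (F t)

section SetSums

variable {X : Type*} [NormedAddCommGroup X]

theorem TotallyBounded.finset_sum [CompleteSpace X] {ι : Type*} (s : Finset ι) {G : ι → Set X}
    (hG : ∀ i ∈ s, TotallyBounded (G i)) : TotallyBounded (∑ i ∈ s, G i) := by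
  classical
  induction s using Finset.induction_on with
  | empty =>
    rw [Finset.sum_empty]
    exact (Set.finite_singleton (0 : X)).totallyBounded
  | insert i s hi ih =>
    rw [Finset.sum_insert hi]
    have h₁ := (hG i (Finset.mem_insert_self i s)).closure.isCompact_of_isClosed
      isClosed_closure
    have h₂ := (ih fun j hj => hG j (Finset.mem_insert_of_mem hj)).closure.isCompact_of_isClosed
      isClosed_closure
    exact (h₁.add h₂).totallyBounded.subset (Set.add_subset_add subset_closure subset_closure)

variable [NormedSpace ℝ X]

theorem TotallyBounded.const_smul_set {s : Set X} (hs : TotallyBounded s) (c : ℝ) :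
    TotallyBounded (c • s) :=
  hs.image (uniformContinuous_const_smul c)

end SetSums

section Rounding

universe u

variable {X : Type u} {H : Type*} [NormedAddCommGroup X] [NormedSpace ℝ X]
  [NormedAddCommGroup H] [InnerProductSpace ℝ H]

theorem exists_inner_map_sub_nonpos (L : X →L[ℝ] H) (v : H) {G : Set X} {z : X}
    (hz : z ∈ convexHull ℝ G) : ∃ f ∈ G, inner ℝ v (L (z - f)) ≤ 0 := by
  by_contra! h
  have hlin : IsLinearMap ℝ fun x => inner ℝ v (L x) :=
    ⟨fun x y => by simp [inner_add_right], fun c x => by simp [inner_smul_right]⟩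
  have hsub : G ⊆ {x | inner ℝ v (L x) < inner ℝ v (L z)} := fun f hf => by
    have := h f hf
    rw [map_sub, inner_sub_right] at this
    simpa using this
  exact lt_irrefl (inner ℝ v (L z)) (convexHull_min hsub (convex_halfSpace_lt hlin _) hz)

/-- Points of convex hulls can be replaced one at a time by points of the sets themselves so that
the squared errors, measured in a Hilbert space, at most add up. -/
theorem exists_norm_sq_map_sum_sub_le (L : X →L[ℝ] H) {ι : Type*} (s : Finset ι) (w : ι → ℝ)
    {G : ι → Set X} {z : ι → X} {D : ℝ} (hz : ∀ i, z i ∈ convexHull ℝ (G i))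
    (hD : ∀ i, ∀ f ∈ G i, ‖L (z i - f)‖ ≤ D) :
    ∃ f : ι → X, (∀ i, f i ∈ G i) ∧
      ‖L (∑ i ∈ s, w i • (z i - f i))‖ ^ 2 ≤ ∑ i ∈ s, w i ^ 2 * D ^ 2 := by
  classical
  induction s using Finset.induction_on with
  | empty =>
    choose f hf _ using fun i => exists_inner_map_sub_nonpos L 0 (hz i)
    exact ⟨f, hf, by simp⟩
  | insert a s ha ih =>
    obtain ⟨f, hf, hs⟩ := ih
    set v := L (∑ i ∈ s, w i • (z i - f i)) with hv
    obtain ⟨g, hg, hin⟩ := exists_inner_map_sub_nonpos L (w a • v) (hz a)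
    refine ⟨Function.update f a g, fun i => ?_, ?_⟩
    · rcases eq_or_ne i a with rfl | h
      · simpa using hg
      · simpa [h] using hf i
    · have hrest : ∑ i ∈ s, w i • (z i - Function.update f a g i)
          = ∑ i ∈ s, w i • (z i - f i) :=
        Finset.sum_congr rfl fun i hi => by
          rw [Function.update_of_ne (ne_of_mem_of_not_mem hi ha)]
      rw [Finset.sum_insert ha, Finset.sum_insert ha, hrest, Function.update_self, map_add,
        ← hv, map_smul, add_comm, norm_add_sq_real, norm_smul, mul_pow, Real.norm_eq_abs, sq_abs,
        inner_smul_right]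
      rw [real_inner_smul_left] at hin
      have hsq : ‖L (z a - g)‖ ^ 2 ≤ D ^ 2 :=
        pow_le_pow_left₀ (norm_nonneg _) (hD a g hg) 2
      have := mul_le_mul_of_nonneg_left hsq (sq_nonneg (w a))
      linarith

/-- The norm of differences of points of a totally bounded set is controlled, up to `ε`, by finitely
many continuous functionals of norm at most one. -/
theorem TotallyBounded.exists_map_euclideanSpace {A : Set X} (hA : TotallyBounded A) {ε : ℝ}
    (hε : 0 < ε) : ∃ (κ : Type u) (_ : Fintype κ) (L : X →L[ℝ] EuclideanSpace ℝ κ),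
      (∀ x j, |L x j| ≤ ‖x‖) ∧ ∀ a ∈ A, ∀ b ∈ A, ∃ j, ‖a - b‖ ≤ L (a - b) j + 4 * ε := by
  obtain ⟨N, -, hNfin, hN⟩ := Metric.finite_approx_of_totallyBounded hA ε hε
  choose φ hφ hφx using fun x : X => exists_dual_vector'' ℝ x
  have := hNfin.fintype
  let L : X →L[ℝ] EuclideanSpace ℝ (N × N) :=
    (EuclideanSpace.equiv (N × N) ℝ).symm.toContinuousLinearMap ∘L
      ContinuousLinearMap.pi fun p => φ ((p.1 : X) - p.2)
  have hL (x : X) (j : N × N) : L x j = φ ((j.1 : X) - j.2) x := rfl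
  have hφle (x y : X) : |φ x y| ≤ ‖y‖ := by
    simpa using (φ x).le_of_opNorm_le (hφ x) y
  refine ⟨N × N, inferInstance, L, fun x j => hφle _ _, fun a ha b hb => ?_⟩
  obtain ⟨p, hp, hap⟩ := Set.mem_iUnion₂.1 (hN ha)
  obtain ⟨q, hq, hbq⟩ := Set.mem_iUnion₂.1 (hN hb)
  refine ⟨(⟨p, hp⟩, ⟨q, hq⟩), ?_⟩
  rw [hL]
  rw [mem_ball_iff_norm] at hap hbq
  have hclose : ‖(a - b) - (p - q)‖ ≤ 2 * ε := by
    rw [show (a - b) - (p - q) = (a - p) - (b - q) by abel]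
    linarith [norm_sub_le (a - p) (b - q)]
  have h₁ : ‖a - b‖ ≤ ‖p - q‖ + ‖(a - b) - (p - q)‖ := by
    linarith [norm_sub_norm_le (a - b) (p - q)]
  have h₂ := neg_le_of_abs_le (hφle (p - q) ((a - b) - (p - q)))
  have h₃ : φ (p - q) (p - q) = ‖p - q‖ := hφx (p - q)
  rw [map_sub] at h₂
  dsimp only
  linarith

end Rounding

namespace TaggedPartition

variable (T : TaggedPartition)

/-- The length of the `i`-th subinterval. -/
noncomputable def length (i : Fin T.n) : ℝ := T.x i.succ - T.x i.castSucc

theorem length_nonneg (i : Fin T.n) : 0 ≤ T.length i :=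
  sub_nonneg.2 (T.mono i.castSucc_lt_succ.le)

theorem length_le_mesh (i : Fin T.n) : T.length i ≤ T.mesh :=
  le_ciSup (f := T.length) (Set.finite_range _).bddAbove i

theorem sum_length : ∑ i, T.length i = 1 := by
  have h := (Fin.sum_univ_succ T.x).symm.trans (Fin.sum_univ_castSucc T.x)
  simp only [length, Finset.sum_sub_distrib]
  rw [T.x_zero, T.x_last] at h
  linarith

theorem tag_mem_Icc (i : Fin T.n) : T.t i ∈ Set.Icc (0 : ℝ) 1 :=
  ⟨(T.x_zero.symm.le.trans (T.mono (Fin.zero_le _))).trans (T.tag_mem i).1,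
    (T.tag_mem i).2.trans ((T.mono (Fin.le_last _)).trans T.x_last.le)⟩

theorem sum_length_sq_le : ∑ i, T.length i ^ 2 ≤ T.mesh := by
  calc ∑ i, T.length i ^ 2 ≤ ∑ i, T.mesh * T.length i := Finset.sum_le_sum fun i _ => by
        rw [sq]
        exact mul_le_mul_of_nonneg_right (T.length_le_mesh i) (T.length_nonneg i)
    _ = T.mesh := by rw [← Finset.mul_sum, T.sum_length, mul_one]

/-- The partition into `m + 1` intervals of equal length, tagged by left endpoints. -/
noncomputable def uniform (m : ℕ) : TaggedPartition where
  n := m + 1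
  npos := m.succ_pos
  x i := (i : ℝ) / (m + 1)
  t i := (i : ℝ) / (m + 1)
  mono i j h := by
    have : (i : ℝ) ≤ j := by exact_mod_cast h
    dsimp only
    gcongr
  x_zero := by simp
  x_last := by
    have : (m : ℝ) + 1 ≠ 0 := by positivity
    simp [this]
  tag_mem i := by
    refine ⟨by simp, ?_⟩
    simp only [Fin.val_succ, Nat.cast_add, Nat.cast_one]
    gcongr
    linarith

theorem x_castSucc_uniform (m : ℕ) (i : Fin (uniform m).n) :
    (uniform m).x i.castSucc = (i : ℝ) / (m + 1) := rfl

theorem x_succ_uniform (m : ℕ) (i : Fin (uniform m).n) :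
    (uniform m).x i.succ = ((i : ℝ) + 1) / (m + 1) := by
  rw [← Nat.cast_succ]
  rfl

theorem length_uniform (m : ℕ) (i : Fin (uniform m).n) :
    (uniform m).length i = 1 / ((m : ℝ) + 1) := by
  rw [length, x_succ_uniform, x_castSucc_uniform]
  ring

theorem mesh_uniform (m : ℕ) : (uniform m).mesh = 1 / ((m : ℝ) + 1) := by
  have : Nonempty (Fin (uniform m).n) := ⟨⟨0, (uniform m).npos⟩⟩
  exact (congrArg iSup (funext (length_uniform m))).trans ciSup_const

theorem exists_mem_uniform (m : ℕ) {t : ℝ} (ht : t ∈ Set.Icc (0 : ℝ) 1) :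
    ∃ i : Fin (uniform m).n,
      t ∈ Set.Icc ((uniform m).x i.castSucc) ((uniform m).x i.succ) := by
  have hm : (0 : ℝ) < (m : ℝ) + 1 := by positivity
  have h0 : 0 ≤ t * (m + 1) := mul_nonneg ht.1 hm.le
  rcases ht.2.eq_or_lt with rfl | h1
  · refine ⟨⟨m, m.lt_succ_self⟩, ?_, ?_⟩
    · rw [x_castSucc_uniform, div_le_one hm]
      linarith
    · rw [x_succ_uniform, div_self hm.ne']
  · have hlt : ⌊t * (m + 1)⌋₊ < m + 1 := by
      rw [Nat.floor_lt h0]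
      push_cast
      nlinarith
    refine ⟨⟨_, hlt⟩, ?_, ?_⟩
    · rw [x_castSucc_uniform, div_le_iff₀ hm]
      exact Nat.floor_le h0
    · rw [x_succ_uniform, le_div_iff₀ hm]
      exact (Nat.lt_floor_add_one _).le

/-- Change the tag of the `i`-th subinterval to `s`. -/
noncomputable def updateTag (i : Fin T.n) {s : ℝ}
    (hs : s ∈ Set.Icc (T.x i.castSucc) (T.x i.succ)) : TaggedPartition where
  n := T.n
  npos := T.npos
  x := T.x
  t := Function.update T.t i s
  mono := T.mono
  x_zero := T.x_zero
  x_last := T.x_last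
  tag_mem j := by
    rcases eq_or_ne j i with rfl | h
    · simpa using hs
    · simpa [h] using T.tag_mem j

end TaggedPartition

section RiemannSum

variable {X : Type*} [NormedAddCommGroup X] [NormedSpace ℝ X] {F : ℝ → Set X}

theorem mem_setRiemannSum {T : TaggedPartition} {x : X} :
    x ∈ setRiemannSum F T ↔
      ∃ f : Fin T.n → X, (∀ i, f i ∈ F (T.t i)) ∧ ∑ i, T.length i • f i = x := by
  rw [setRiemannSum, Set.mem_fintype_sum]
  constructor
  · rintro ⟨g, hg, rfl⟩
    choose f hf hfg using hg
    exact ⟨f, hf, Finset.sum_congr rfl fun i _ => hfg i⟩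
  · rintro ⟨f, hf, rfl⟩
    exact ⟨_, fun i => Set.smul_mem_smul_set (hf i), rfl⟩

theorem setRiemannSum_mono {G : ℝ → Set X} (h : ∀ t, F t ⊆ G t) (T : TaggedPartition) :
    setRiemannSum F T ⊆ setRiemannSum G T := by
  intro x hx
  obtain ⟨f, hf, rfl⟩ := mem_setRiemannSum.1 hx
  exact mem_setRiemannSum.2 ⟨f, fun i => h _ (hf i), rfl⟩

theorem setRiemannSum_nonempty (hF : ∀ t ∈ Set.Icc (0 : ℝ) 1, (F t).Nonempty)
    (T : TaggedPartition) : (setRiemannSum F T).Nonempty := by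
  choose f hf using fun i => hF _ (T.tag_mem_Icc i)
  exact ⟨_, mem_setRiemannSum.2 ⟨f, hf, rfl⟩⟩

theorem totallyBounded_setRiemannSum [CompleteSpace X]
    (hF : ∀ t ∈ Set.Icc (0 : ℝ) 1, TotallyBounded (F t)) (T : TaggedPartition) :
    TotallyBounded (setRiemannSum F T) :=
  TotallyBounded.finset_sum _ fun i _ => (hF _ (T.tag_mem_Icc i)).const_smul_set _

/-- If the Riemann sums of `F` over fine tagged partitions stay in a fixed bounded set, then `F` is
bounded on `[0,1]`. -/
theorem exists_norm_le_of_setRiemannSum_subset (hF : ∀ t ∈ Set.Icc (0 : ℝ) 1, (F t).Nonempty)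
    {δ R : ℝ} (hδ : 0 < δ)
    (hR : ∀ T : TaggedPartition, T.mesh < δ → ∀ x ∈ setRiemannSum F T, ‖x‖ ≤ R) :
    ∃ M, 0 ≤ M ∧ ∀ t ∈ Set.Icc (0 : ℝ) 1, ∀ f ∈ F t, ‖f‖ ≤ M := by
  obtain ⟨m, hm⟩ := exists_nat_one_div_lt hδ
  set T := TaggedPartition.uniform m
  have hm0 : (0 : ℝ) < (m : ℝ) + 1 := by positivity
  choose g hg using fun i => hF _ (T.tag_mem_Icc i)
  obtain ⟨x₀, hx₀⟩ := setRiemannSum_nonempty hF T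
  have hTm : T.mesh < δ := by rwa [TaggedPartition.mesh_uniform]
  have hR0 : 0 ≤ R := (norm_nonneg _).trans (hR T hTm x₀ hx₀)
  refine ⟨(m + 1) * (R + ∑ i, ‖T.length i • g i‖), by positivity, fun t ht f hf => ?_⟩
  obtain ⟨i, hi⟩ := TaggedPartition.exists_mem_uniform m ht
  have hmem : ∑ j, T.length j • Function.update g i f j ∈ setRiemannSum F (T.updateTag i hi) := by
    have hupd (j : Fin T.n) : Function.update g i f j ∈ F (Function.update T.t i t j) := by
      rcases eq_or_ne j i with rfl | h
      · simpa using hf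
      · simpa [h] using hg j
    exact mem_setRiemannSum.2 ⟨Function.update g i f, hupd, rfl⟩
  have hb := hR (T.updateTag i hi) hTm _ hmem
  rw [← Finset.add_sum_erase _ _ (Finset.mem_univ i), Function.update_self] at hb
  have hrest : ‖∑ j ∈ Finset.univ.erase i, T.length j • Function.update g i f j‖
      ≤ ∑ j, ‖T.length j • g j‖ := by
    rw [Finset.sum_congr rfl fun j hj => by
      rw [Function.update_of_ne (Finset.ne_of_mem_erase hj)]]
    exact (norm_sum_le _ _).trans (Finset.sum_le_sum_of_subset_of_nonneg (Finset.erase_subset _ _)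
      fun _ _ _ => norm_nonneg _)
  have hone : ‖T.length i • f‖ ≤ R + ∑ j, ‖T.length j • g j‖ :=
    (norm_le_add_norm_add _ _).trans (add_le_add hb hrest)
  rw [TaggedPartition.length_uniform, norm_smul, Real.norm_of_nonneg (by positivity),
    one_div_mul_eq_div, div_le_iff₀ hm0] at hone
  linarith

end RiemannSum

/-- In any Banach space, if `F` has precompact (totally bounded) values and `conv F` is
Riemann integrable, then `F` is Riemann integrable. -/
theorem stmt16 {X : Type*} [NormedAddCommGroup X] [NormedSpace ℝ X] [CompleteSpace X]
    (F : ℝ → Set X) (hF : IsMultifunction F)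
    (hpc : ∀ t ∈ Set.Icc (0 : ℝ) 1, TotallyBounded (F t))
    (hconv : SetRiemannIntegrable (fun t => convexHull ℝ (F t))) :
    SetRiemannIntegrable F := by
  obtain ⟨A, hAne, hAcl, hAbd, hA⟩ := hconv
  set G : ℝ → Set X := fun t => convexHull ℝ (F t)
  have hFne : ∀ t ∈ Set.Icc (0 : ℝ) 1, (F t).Nonempty := fun t ht => (hF t ht).1
  have hFG : ∀ t, F t ⊆ G t := fun t => subset_convexHull ℝ (F t)
  have hGne : ∀ t ∈ Set.Icc (0 : ℝ) 1, (G t).Nonempty := fun t ht => (hFne t ht).mono (hFG t)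
  have hGtb (T : TaggedPartition) : TotallyBounded (setRiemannSum G T) :=
    totallyBounded_setRiemannSum (fun t ht => totallyBounded_convexHull.2 (hpc t ht)) T
  have htop (T : TaggedPartition) : Metric.hausdorffEDist (setRiemannSum G T) A ≠ ⊤ :=
    Metric.hausdorffEDist_ne_top_of_nonempty_of_bounded (setRiemannSum_nonempty hGne T) hAne
      (hGtb T).isBounded hAbd
  have hAtb : TotallyBounded A := by
    refine Metric.totallyBounded_iff.2 fun ε hε => ?_
    obtain ⟨δ, hδ, hT⟩ := hA (ε / 2) (half_pos hε)
    obtain ⟨m, hm⟩ := exists_nat_one_div_lt hδ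
    rw [← TaggedPartition.mesh_uniform] at hm
    obtain ⟨N, hN, hcov⟩ := Metric.totallyBounded_iff.1 (hGtb (.uniform m)) (ε / 2) (half_pos hε)
    refine ⟨N, hN, fun a ha => ?_⟩
    obtain ⟨z, hz, hza⟩ := Metric.exists_dist_lt_of_hausdorffDist_lt' ha (hT _ hm) (htop _)
    obtain ⟨y, hy, hzy⟩ := Set.mem_iUnion₂.1 (hcov hz)
    refine Set.mem_iUnion₂.2 ⟨y, hy, ?_⟩
    rw [Metric.mem_ball] at hzy ⊢
    rw [dist_comm] at hza
    linarith [dist_triangle a z y]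
  obtain ⟨M, hM0, hM⟩ : ∃ M, 0 ≤ M ∧ ∀ t ∈ Set.Icc (0 : ℝ) 1, ∀ f ∈ G t, ‖f‖ ≤ M := by
    obtain ⟨δ, hδ, hT⟩ := hA 1 one_pos
    obtain ⟨R, hR⟩ := hAbd.exists_norm_le
    refine exists_norm_le_of_setRiemannSum_subset (R := R + 1) hGne hδ fun T hTm x hx => ?_
    obtain ⟨a, ha, hxa⟩ := Metric.exists_dist_lt_of_hausdorffDist_lt hx (hT T hTm) (htop T)
    rw [dist_eq_norm] at hxa
    linarith [hR a ha, norm_sub_norm_le x a]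
  refine ⟨A, hAne, hAcl, hAbd, fun ε hε => ?_⟩
  set η := ε / 9 with hη
  have hη0 : 0 < η := by positivity
  obtain ⟨κ, _, L, hL, hnorming⟩ := hAtb.exists_map_euclideanSpace hη0
  obtain ⟨δ, hδ, hT⟩ := hA η hη0
  set D := ‖L‖ * (2 * M)
  refine ⟨min δ (η ^ 2 / (D ^ 2 + 1)), by positivity, fun T hTm => ?_⟩
  obtain ⟨hTδ, hTD⟩ := lt_min_iff.1 hTm
  have hclose {x : X} (hx : x ∈ setRiemannSum F T) : ∃ a ∈ A, dist x a < η :=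
    Metric.exists_dist_lt_of_hausdorffDist_lt (setRiemannSum_mono hFG T hx) (hT T hTδ) (htop T)
  refine lt_of_le_of_lt (Metric.hausdorffDist_le_of_mem_dist (r := 8 * η) (by positivity)
    (fun x hx => ?_) fun a ha => ?_) (by linarith)
  · obtain ⟨a, ha, hxa⟩ := hclose hx
    exact ⟨a, ha, by linarith⟩
  · obtain ⟨x, hx, hxa⟩ := Metric.exists_dist_lt_of_hausdorffDist_lt' ha (hT T hTδ) (htop T)
    obtain ⟨z, hz, rfl⟩ := mem_setRiemannSum.1 hx
    obtain ⟨f, hf, hle⟩ := exists_norm_sq_map_sum_sub_le L Finset.univ T.length (D := D) hz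
      fun i f hf => L.le_opNorm_of_le <| by
        linarith [norm_sub_le (z i) f, hM _ (T.tag_mem_Icc i) _ (hz i),
          hM _ (T.tag_mem_Icc i) _ (hFG _ hf)]
    have hy : ∑ i, T.length i • f i ∈ setRiemannSum F T := mem_setRiemannSum.2 ⟨f, hf, rfl⟩
    obtain ⟨b, hb, hyb⟩ := hclose hy
    simp only [smul_sub, Finset.sum_sub_distrib] at hle
    set x := ∑ i, T.length i • z i
    set y := ∑ i, T.length i • f i
    refine ⟨y, hy, ?_⟩
    have hround : ‖L (x - y)‖ ≤ η := by
      refine le_of_sq_le_sq (hle.trans ?_) hη0.le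
      rw [← Finset.sum_mul]
      have h₁ := mul_le_mul_of_nonneg_right T.sum_length_sq_le (sq_nonneg D)
      have h₂ := (lt_div_iff₀ (by positivity)).1 hTD
      have h₃ : 0 ≤ T.mesh := (T.length_nonneg ⟨0, T.npos⟩).trans (T.length_le_mesh _)
      linarith
    obtain ⟨j, hj⟩ := hnorming a ha b hb
    have hxy : L (x - y) j ≤ η :=
      ((le_abs_self _).trans (PiLp.norm_apply_le (L (x - y)) j)).trans hround
    rw [dist_eq_norm] at hxa hyb ⊢
    have hax : L (a - x) j ≤ η := (le_abs_self _).trans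
      ((hL _ j).trans (norm_sub_rev x a ▸ hxa.le))
    have hybj : L (y - b) j ≤ η := (le_abs_self _).trans ((hL _ j).trans hyb.le)
    have hsplit : L (a - b) j = L (a - x) j + L (x - y) j + L (y - b) j := by
      simp only [map_sub, PiLp.sub_apply]
      ring
    rw [norm_sub_rev] at hyb
    linarith [norm_sub_le_norm_sub_add_norm_sub a b y]
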